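/- arXiv:1801.06431 — 4 statements merged into one kernel-verified Lean document; each statement's English description precedes it below -/
import Mathlib

section
/- For quaternions a and b, there exists a nonzero quaternion c with b = c⁻¹·a·c if and only if Re(a) = Re(b) and |a| = |b|. -/
noncomputable section

open Quaternion

theorem Quaternion.re_mul_comm (x y : Quaternion ℝ) : (x * y).re = (y * x).re := by
  simp only [re_mul]
  ring

/-- If `a` and `b` have the same real part and norm, hence the same characteristic polynomial,
then `a * x - x * star b` intertwines them. -/
theorem Quaternion.mul_intertwiner {a b : Quaternion ℝ} (hre : a.re = b.re)
    (hn : normSq a = normSq b) (x : Quaternion ℝ) :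
    a * (a * x - x * star b) = (a * x - x * star b) * b := by
  have hb : star b = (2 * b.re : ℝ) - b := by
    rw [← self_add_star']
    abel
  have ha : star a = (2 * b.re : ℝ) - a := by
    rw [← hre, ← self_add_star']
    abel
  have key : a * star a = star b * b := by rw [self_mul_star, star_mul_self, hn]
  have hcomm : a * (star a * x) = x * (star b * b) := by
    rw [← mul_assoc, key, star_mul_self, coe_commutes]
  have hsum : a * x - x * star b = x * b - star a * x := by
    rw [ha, hb, mul_sub, sub_mul, coe_commutes]
    abel
  rw [hsum, mul_sub, hcomm, ← hsum, sub_mul, mul_assoc, mul_assoc]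

theorem Quaternion.eq_of_forall_mul_eq_mul_star {a b : Quaternion ℝ}
    (h : ∀ x, a * x = x * star b) : a = b := by
  obtain rfl : a = star b := by simpa using h 1
  simp only [Quaternion.ext_iff, re_mul, imI_mul, imJ_mul, imK_mul, re_star, imI_star, imJ_star,
    imK_star] at h ⊢
  have hi := h ⟨0, 1, 0, 0⟩
  have hj := h ⟨0, 0, 1, 0⟩
  refine ⟨trivial, ?_, ?_, ?_⟩ <;> linarith [hi.2.2.1, hi.2.2.2, hj.2.2.2]

/-- **Similarity of quaternions.** Two quaternions `a`, `b` are similar (conjugate by a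
nonzero quaternion) if and only if they have the same real part and the same norm. -/
theorem quaternion_similar_iff (a b : Quaternion ℝ) :
    (∃ c : Quaternion ℝ, c ≠ 0 ∧ b = c⁻¹ * a * c) ↔ a.re = b.re ∧ ‖a‖ = ‖b‖ := by
  constructor
  · rintro ⟨c, hc, rfl⟩
    constructor
    · rw [Quaternion.re_mul_comm, ← mul_assoc, mul_inv_cancel₀ hc, one_mul]
    · have : ‖c‖ ≠ 0 := norm_ne_zero_iff.mpr hc
      rw [norm_mul, norm_mul, norm_inv]
      field_simp
  · rintro ⟨hre, hnorm⟩
    have hn : normSq a = normSq b := by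
      rw [normSq_eq_norm_mul_self, normSq_eq_norm_mul_self, hnorm]
    by_cases h : ∀ x, a * x = x * star b
    · exact ⟨1, one_ne_zero, by simp [Quaternion.eq_of_forall_mul_eq_mul_star h]⟩
    · obtain ⟨x, hx⟩ := not_forall.mp h
      have hc := sub_ne_zero.mpr hx
      exact ⟨_, hc, by
        rw [mul_assoc, Quaternion.mul_intertwiner hre hn, inv_mul_cancel_left₀ hc]⟩
end
end

section
/- Let n ≥ 1 and let A be an (n+1)×(n+1) quaternionic matrix with A* H A = H (i.e. A ∈ Sp(n,1)). Let A_ℂ be the (2n+2)×(2n+2) complex matrix obtained from the block embedding A = A₁ + j·A₂ ↦ [[A₁, −conj(A₂)], [A₂, conj(A₁)]]. Then the characteristic polynomial χ of A_ℂ is monic of degree 2n+2, all of its coefficients are real, its constant coefficient equals 1, and its coefficients are palindromic: for every 0 ≤ k ≤ 2n+2, the coefficient of x^k in χ equals the coefficient of x^{2n+2−k} in χ. -/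
noncomputable section

open Quaternion Matrix

abbrev ℍq : Type := Quaternion ℝ

/-- The Hermitian form matrix of signature (n,1): `H_{1,n+1} = H_{n+1,1} = 1`,
`H_{kk} = 1` for `2 ≤ k ≤ n`, all other entries `0` (1-based indexing). -/
def qHmat (n : ℕ) : Matrix (Fin (n+1)) (Fin (n+1)) ℍq := fun k j =>
  if (k = 0 ∧ j = Fin.last n) ∨ (k = Fin.last n ∧ j = 0) then 1
  else if k = j ∧ k ≠ 0 ∧ k ≠ Fin.last n then 1 else 0

/-- First complex component of a quaternion `q = q₁ + j·q₂`. -/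
def qc1 (q : ℍq) : ℂ := ⟨q.re, q.imI⟩

/-- Second complex component of a quaternion `q = q₁ + j·q₂`. -/
def qc2 (q : ℍq) : ℂ := ⟨q.imJ, -q.imK⟩

/-- The block embedding `A = A₁ + j·A₂ ↦ [[A₁, −conj A₂], [A₂, conj A₁]]`. -/
def qembed (N : ℕ) (A : Matrix (Fin N) (Fin N) ℍq) :
    Matrix (Fin N ⊕ Fin N) (Fin N ⊕ Fin N) ℂ :=
  Matrix.fromBlocks (A.map qc1) (-(A.map (fun q => starRingEnd ℂ (qc2 q))))
    (A.map qc2) (A.map (fun q => starRingEnd ℂ (qc1 q)))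

/-- The characteristic polynomial of a symplectic matrix is self-reciprocal. -/
theorem SymplecticGroup.reverse_charpoly {l R : Type*} [DecidableEq l] [Fintype l] [CommRing R]
    {M : Matrix (l ⊕ l) (l ⊕ l) R} (hM : M ∈ symplecticGroup l R) :
    M.charpoly.reverse = M.charpoly := by
  have hdet : M.det = 1 := SymplecticGroup.det_eq_one hM
  have hinv : M⁻¹ = -J l R * Mᵀ * J l R :=
    (SymplecticGroup.inv_eq_symplectic_inv M hM)
  have h1 : M⁻¹.charpoly = M.charpoly := by
    rw [hinv, Matrix.mul_assoc, charpoly_mul_comm, Matrix.mul_assoc, Matrix.mul_neg, J_squared,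
      neg_neg, Matrix.mul_one, charpoly_transpose]
  have h2 := M.charpoly_inv ((isUnit_iff_isUnit_det M).2 (by simp [hdet]))
  rw [h1, hdet, Fintype.card_sum, Even.neg_one_pow (Even.add_self _)] at h2
  rw [Matrix.reverse_charpoly]
  simpa using h2.symm

theorem qc1_mul (a b : ℍq) : qc1 (a * b) = qc1 a * qc1 b - starRingEnd ℂ (qc2 a) * qc2 b := by
  apply Complex.ext <;> simp [qc1, qc2] <;> ring

theorem qc2_mul (a b : ℍq) : qc2 (a * b) = qc2 a * qc1 b + starRingEnd ℂ (qc1 a) * qc2 b := by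
  apply Complex.ext <;> simp [qc1, qc2] <;> ring

/-- `qc1` as an additive homomorphism. -/
def qc1Hom : ℍq →+ ℂ where
  toFun := qc1
  map_zero' := by apply Complex.ext <;> simp [qc1]
  map_add' a b := by apply Complex.ext <;> simp [qc1]

/-- `qc2` as an additive homomorphism. -/
def qc2Hom : ℍq →+ ℂ where
  toFun := qc2
  map_zero' := by apply Complex.ext <;> simp [qc2]
  map_add' a b := by apply Complex.ext <;> simp [qc2, add_comm]

theorem qc1_sum {ι : Type*} (s : Finset ι) (f : ι → ℍq) :
    qc1 (∑ i ∈ s, f i) = ∑ i ∈ s, qc1 (f i) :=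
  map_sum qc1Hom f s

theorem qc2_sum {ι : Type*} (s : Finset ι) (f : ι → ℍq) :
    qc2 (∑ i ∈ s, f i) = ∑ i ∈ s, qc2 (f i) :=
  map_sum qc2Hom f s

theorem qembed_mul {N : ℕ} (A B : Matrix (Fin N) (Fin N) ℍq) :
    qembed N (A * B) = qembed N A * qembed N B := by
  rw [qembed, qembed, qembed, fromBlocks_multiply]
  congr 1 <;> ext i k <;>
    simp [Matrix.mul_apply, qc1_sum, qc2_sum, qc1_mul, qc2_mul, Finset.sum_add_distrib,
      Finset.sum_sub_distrib] <;> ring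

theorem qembed_conjTranspose {N : ℕ} (A : Matrix (Fin N) (Fin N) ℍq) :
    qembed N Aᴴ = (qembed N A)ᴴ := by
  rw [qembed, qembed, fromBlocks_conjTranspose]
  congr 1 <;> ext i k <;> apply Complex.ext <;> simp [qc1, qc2]

theorem qembed_map_conj_mul_J {N : ℕ} (A : Matrix (Fin N) (Fin N) ℍq) :
    J (Fin N) ℂ * (qembed N A).map (starRingEnd ℂ) = qembed N A * J (Fin N) ℂ := by
  rw [qembed, J, fromBlocks_map, fromBlocks_multiply, fromBlocks_multiply]
  congr 1 <;> ext i k <;> simp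

theorem qembed_transpose_mul_J {N : ℕ} (A : Matrix (Fin N) (Fin N) ℍq) :
    (qembed N A)ᵀ * J (Fin N) ℂ = J (Fin N) ℂ * (qembed N A)ᴴ := by
  have h := congrArg conjTranspose (qembed_map_conj_mul_J A)
  have hJ : (J (Fin N) ℂ)ᴴ = -J (Fin N) ℂ := by
    simp [J, fromBlocks_conjTranspose, fromBlocks_neg]
  have hE : ((qembed N A).map (starRingEnd ℂ))ᴴ = (qembed N A)ᵀ := by
    ext i k; simp
  rw [conjTranspose_mul, conjTranspose_mul, hJ, hE, Matrix.mul_neg, Matrix.neg_mul] at h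
  exact neg_injective h

theorem qembed_charpoly_map_conj {N : ℕ} (A : Matrix (Fin N) (Fin N) ℍq) :
    (qembed N A).charpoly.map (starRingEnd ℂ) = (qembed N A).charpoly := by
  have h : (qembed N A).map (starRingEnd ℂ) = -J (Fin N) ℂ * (qembed N A * J (Fin N) ℂ) := by
    rw [← qembed_map_conj_mul_J, ← Matrix.mul_assoc, Matrix.neg_mul, J_squared, neg_neg,
      Matrix.one_mul]
  rw [← charpoly_map, h, charpoly_mul_comm, Matrix.mul_assoc, Matrix.mul_neg, J_squared, neg_neg,
    Matrix.mul_one]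

theorem qembed_qHmat (n : ℕ) :
    ∃ h : Matrix (Fin (n + 1)) (Fin (n + 1)) ℂ,
      h * h = 1 ∧ hᵀ = h ∧ qembed (n + 1) (qHmat n) = fromBlocks h 0 0 h := by
  refine ⟨(Equiv.swap 0 (Fin.last n)).permMatrix ℂ, ?_, ?_, ?_⟩
  · rw [← permMatrix_mul, Equiv.swap_mul_self, permMatrix_one]
  · rw [transpose_permMatrix, Equiv.swap_inv]
  · have h : ∀ i k, qHmat n i k = if Equiv.swap 0 (Fin.last n) i = k then 1 else 0 := by
      intro i k
      rw [qHmat, Equiv.swap_apply_def]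
      grind
    rw [qembed]
    congr 1 <;> ext i k <;>
      simp only [Equiv.Perm.permMatrix, PEquiv.toMatrix_apply, Matrix.map_apply,
        Matrix.neg_apply, h] <;>
      split_ifs <;> apply Complex.ext <;> simp_all [qc1, qc2]

/-- The complex embedding of an element of `Sp(n,1)` is similar to a symplectic matrix. -/
theorem exists_mem_symplecticGroup_charpoly_eq {n : ℕ} {A : Matrix (Fin (n + 1)) (Fin (n + 1)) ℍq}
    (hA : Aᴴ * qHmat n * A = qHmat n) :
    ∃ M ∈ symplecticGroup (Fin (n + 1)) ℂ, M.charpoly = (qembed (n + 1) A).charpoly := by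
  obtain ⟨h, hh, ht, hK⟩ := qembed_qHmat n
  have hE := congrArg (qembed (n + 1)) hA
  rw [qembed_mul, qembed_mul, qembed_conjTranspose, hK] at hE
  have hET := qembed_transpose_mul_J A
  set E := qembed (n + 1) A
  set P : Matrix (Fin (n + 1) ⊕ Fin (n + 1)) (Fin (n + 1) ⊕ Fin (n + 1)) ℂ :=
    fromBlocks 1 0 0 h with hP
  have hPP : P * P = 1 := by simp [hP, fromBlocks_multiply, hh]
  have hPT : Pᵀ = P := by simp [hP, fromBlocks_transpose, ht]
  have hPJ : P * J (Fin (n + 1)) ℂ * P = J (Fin (n + 1)) ℂ * fromBlocks h 0 0 h := by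
    simp [hP, J, fromBlocks_multiply]
  have hEJ : Eᵀ * (P * J (Fin (n + 1)) ℂ * P) * E = P * J (Fin (n + 1)) ℂ * P := by
    rw [hPJ, ← Matrix.mul_assoc, hET, Matrix.mul_assoc, Matrix.mul_assoc, ← Matrix.mul_assoc Eᴴ, hE]
  refine ⟨P * E * P, SymplecticGroup.mem_iff'.2 ?_, ?_⟩
  · calc (P * E * P)ᵀ * J (Fin (n + 1)) ℂ * (P * E * P)
        = P * (Eᵀ * (P * J (Fin (n + 1)) ℂ * P) * E) * P := by
          simp only [transpose_mul, hPT, Matrix.mul_assoc]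
      _ = (P * P) * J (Fin (n + 1)) ℂ * (P * P) := by
          rw [hEJ]; simp only [Matrix.mul_assoc]
      _ = J (Fin (n + 1)) ℂ := by rw [hPP, Matrix.one_mul, Matrix.mul_one]
  · rw [charpoly_mul_comm, ← Matrix.mul_assoc, hPP, Matrix.one_mul]


/-- **Real, self-dual characteristic polynomial.** For `A ∈ Sp(n,1)`, the characteristic
polynomial of the complex matrix `A_ℂ` is monic of degree `2n+2`, has real coefficients,
constant coefficient `1`, and palindromic coefficients. -/
theorem charpoly_of_sp_palindromic (n : ℕ) (hn : 1 ≤ n)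
    (A : Matrix (Fin (n+1)) (Fin (n+1)) ℍq)
    (hA : Aᴴ * qHmat n * A = qHmat n) :
    (qembed (n+1) A).charpoly.Monic ∧
    (qembed (n+1) A).charpoly.natDegree = 2*n+2 ∧
    (∀ k : ℕ, ((qembed (n+1) A).charpoly.coeff k).im = 0) ∧
    (qembed (n+1) A).charpoly.coeff 0 = 1 ∧
    (∀ k : ℕ, k ≤ 2*n+2 →
      (qembed (n+1) A).charpoly.coeff k = (qembed (n+1) A).charpoly.coeff (2*n+2-k)) := by
  have hdeg : (qembed (n+1) A).charpoly.natDegree = 2*n+2 := by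
    rw [charpoly_natDegree_eq_dim]
    simp
    ring
  obtain ⟨M, hM, hMA⟩ := exists_mem_symplecticGroup_charpoly_eq hA
  have hrev := SymplecticGroup.reverse_charpoly hM
  rw [hMA] at hrev
  have hpal : ∀ k : ℕ, k ≤ 2*n+2 →
      (qembed (n+1) A).charpoly.coeff k = (qembed (n+1) A).charpoly.coeff (2*n+2-k) := by
    intro k hk
    conv_lhs => rw [← hrev, Polynomial.coeff_reverse, hdeg, Polynomial.revAt_le hk]
  have hmonic := charpoly_monic (qembed (n+1) A)
  refine ⟨hmonic, hdeg, fun k => ?_, ?_, hpal⟩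
  · rw [← Complex.conj_eq_iff_im, ← Polynomial.coeff_map, qembed_charpoly_map_conj]
  · rw [hpal 0 (Nat.zero_le _), Nat.sub_zero, ← hdeg, hmonic.coeff_natDegree]
end
end

section
/- Let 3 ≤ i ≤ m and let z₁, …, z_m be nonzero vectors in ℍ^{n+1} with z₁, …, z_i null, z_{i+1}, …, z_m negative, and z_k ∉ z_l·ℍ for all k ≠ l. Then there exist nonzero quaternions λ₁, …, λ_m such that the Gram matrix G = (g_{kj}) of (z₁λ₁, …, z_mλ_m) satisfies: g_{kk} = 0 for 1 ≤ k ≤ i, |g_{23}| = 1, g_{1j} = 1 for 2 ≤ j ≤ i, g_{kk} = −1 for i+1 ≤ k ≤ m, and g_{1j} is a positive real number for i+1 ≤ j ≤ m. -/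
noncomputable section

open Quaternion Matrix
open scoped Classical

/-- `herm n z w = ⟨z,w⟩ = w* H z`. -/
def herm (n : ℕ) (z w : Fin (n+1) → ℍq) : ℍq :=
  ∑ k, ∑ j, star (w k) * qHmat n k j * z j

/-- Two `m`-tuples of vectors are PSp(n,1)-congruent if some `C ∈ Sp(n,1)` carries each
`p k` to `q k` up to a nonzero right quaternionic scalar. -/
def PSpCongruent (n m : ℕ) (p q : Fin m → Fin (n+1) → ℍq) : Prop :=
  ∃ C : Matrix (Fin (n+1)) (Fin (n+1)) ℍq, Cᴴ * qHmat n * C = qHmat n ∧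
    ∃ μ : Fin m → ℍq, (∀ k, μ k ≠ 0) ∧ ∀ k, C.mulVec (p k) = fun j => q k j * μ k

/-- An `m`-tuple `p` (first `i` entries null, the rest negative, pairwise projectively
distinct) is semi-normalized if its Gram matrix `g_{kj} = ⟨p_j, p_k⟩` satisfies
`g_{kk} = 0` for `1 ≤ k ≤ i`, `|g_{23}| = 1`, `g_{1j} = 1` for `2 ≤ j ≤ i`,
`g_{kk} = −1` for `i+1 ≤ k ≤ m`, and `g_{1j}` positive real for `i+1 ≤ j ≤ m`
(1-based indexing). -/
def SemiNormalized (n m i : ℕ) (p : Fin m → Fin (n+1) → ℍq) : Prop :=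
  (∀ k, p k ≠ 0) ∧
  (∀ k l : Fin m, k ≠ l → ∀ c : ℍq, p k ≠ fun j => p l j * c) ∧
  (∀ k : Fin m, (k : ℕ) < i → herm n (p k) (p k) = 0) ∧
  (∀ k j : Fin m, (k : ℕ) = 1 → (j : ℕ) = 2 → ‖herm n (p j) (p k)‖ = 1) ∧
  (∀ k j : Fin m, (k : ℕ) = 0 → 1 ≤ (j : ℕ) → (j : ℕ) < i → herm n (p j) (p k) = 1) ∧
  (∀ k : Fin m, i ≤ (k : ℕ) → herm n (p k) (p k) = -1) ∧
  (∀ k j : Fin m, (k : ℕ) = 0 → i ≤ (j : ℕ) → ∃ r : ℝ, 0 < r ∧ herm n (p j) (p k) = (r : ℍq))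

/-- The Korányi–Reimann quaternionic cross ratio. -/
def crossRatio (n : ℕ) (z1 z2 z3 z4 : Fin (n+1) → ℍq) : ℍq :=
  herm n z3 z1 * (herm n z3 z2)⁻¹ * herm n z4 z2 * (herm n z4 z1)⁻¹

/-- The quaternionic Cartan angular invariant
`𝔸(z₁,z₂,z₃) = arccos(Re(−T)/|T|)` with `T = ⟨z₁,z₂⟩⟨z₂,z₃⟩⟨z₃,z₁⟩`. -/
def angInv (n : ℕ) (z1 z2 z3 : Fin (n+1) → ℍq) : ℝ :=
  Real.arccos ((-(herm n z1 z2 * herm n z2 z3 * herm n z3 z1)).re /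
    ‖herm n z1 z2 * herm n z2 z3 * herm n z3 z1‖)

/-- The rotation invariant `u(g) = Im g / |Im g|` (and `0` if `Im g = 0`). -/
def rotInv (g : ℍq) : ℍq := if g.im = 0 then 0 else (‖g.im‖)⁻¹ • g.im

/-- The distance invariant `d(z,w) = (⟨w,z⟩·⟨z,w⟩)/(⟨w,w⟩·⟨z,z⟩)`. -/
def dInv (n : ℕ) (z w : Fin (n+1) → ℍq) : ℍq :=
  (herm n w z * herm n z w) / (herm n w w * herm n z z)

theorem herm_eq_sum_swap (n : ℕ) (z w : Fin (n+1) → ℍq) :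
    herm n z w = ∑ k, star (w (Equiv.swap 0 (Fin.last n) k)) * z k := by
  have hH : ∀ k j, qHmat n k j = if k = Equiv.swap 0 (Fin.last n) j then 1 else 0 := by
    intro k j
    simp only [qHmat, Equiv.swap_apply_def]
    split_ifs <;> simp_all
  unfold herm
  rw [Finset.sum_comm]
  refine Finset.sum_congr rfl fun j _ => ?_
  simp [hH, mul_ite, ite_mul]

theorem herm_mul_right (n : ℕ) (z w : Fin (n+1) → ℍq) (a b : ℍq) :
    herm n (fun j => z j * a) (fun j => w j * b) = star b * herm n z w * a := by
  simp only [herm_eq_sum_swap, Finset.mul_sum, Finset.sum_mul, star_mul, mul_assoc]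

theorem star_herm (n : ℕ) (z w : Fin (n+1) → ℍq) : star (herm n z w) = herm n w z := by
  simp only [herm_eq_sum_swap, star_sum, star_mul, star_star]
  refine Fintype.sum_equiv (Equiv.swap 0 (Fin.last n)) _ _ fun k => ?_
  simp

theorem herm_sub_left (n : ℕ) (z z' w : Fin (n+1) → ℍq) :
    herm n (z - z') w = herm n z w - herm n z' w := by
  simp only [herm_eq_sum_swap, Pi.sub_apply, mul_sub, Finset.sum_sub_distrib]

theorem herm_sub_right (n : ℕ) (z w w' : Fin (n+1) → ℍq) :
    herm n z (w - w') = herm n z w - herm n z w' := by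
  simp only [herm_eq_sum_swap, Pi.sub_apply, star_sub, sub_mul, Finset.sum_sub_distrib]

theorem herm_eq_of_support_zero {n : ℕ} {v : Fin (n+1) → ℍq} (hv : ∀ k, k ≠ 0 → v k = 0)
    (w : Fin (n+1) → ℍq) : herm n v w = star (w (Fin.last n)) * v 0 := by
  rw [herm_eq_sum_swap, Finset.sum_eq_single 0]
  · simp
  · intro k _ hk
    simp [hv k hk]
  · simp

theorem re_sum {ι : Type*} (s : Finset ι) (f : ι → ℍq) :
    (∑ k ∈ s, f k).re = ∑ k ∈ s, (f k).re :=
  map_sum (AddMonoidHom.mk' (fun q : ℍq => q.re) Quaternion.re_add) f s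

theorem eq_zero_of_herm_self_nonpos {n : ℕ} {u : Fin (n+1) → ℍq} (hlast : u (Fin.last n) = 0)
    {r : ℝ} (hr : r ≤ 0) (hu : herm n u u = (r : ℍq)) : ∀ k, k ≠ 0 → u k = 0 := by
  have hterm : ∀ k, (star (u (Equiv.swap 0 (Fin.last n) k)) * u k).re =
      if k = 0 then 0 else normSq (u k) := by
    intro k
    by_cases h0 : k = 0
    · simp [h0, hlast]
    by_cases hl : k = Fin.last n
    · simp [hl, hlast]
    rw [Equiv.swap_apply_of_ne_of_ne h0 hl, if_neg h0, Quaternion.star_mul_self]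
    simp
  have hsum : ∑ k, (if k = 0 then 0 else normSq (u k)) = r := by
    simp only [← hterm]
    rw [← re_sum, ← herm_eq_sum_swap, hu, Quaternion.re_coe]
  have hnn : ∀ k ∈ Finset.univ, 0 ≤ (if k = 0 then 0 else normSq (u k)) := by
    intro k _
    split_ifs
    · exact le_rfl
    · exact normSq_nonneg
  have hz := (Finset.sum_eq_zero_iff_of_nonneg hnn).1
    (le_antisymm (hsum.trans_le hr) (Finset.sum_nonneg hnn))
  intro k hk
  simpa [hk] using hz k (Finset.mem_univ k)

/-- A nonpositive vector orthogonal to a nonzero null vector is a multiple of it. -/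
theorem exists_eq_mul_of_herm_eq_zero {n : ℕ} {z w : Fin (n+1) → ℍq} (hz : z ≠ 0)
    (hzz : herm n z z = 0) {r : ℝ} (hr : r ≤ 0) (hww : herm n w w = (r : ℍq))
    (hwz : herm n w z = 0) : ∃ c : ℍq, w = fun j => z j * c := by
  have hzw : herm n z w = 0 := by rw [← star_herm, hwz, star_zero]
  by_cases hlast : z (Fin.last n) = 0
  · have hz' := eq_zero_of_herm_self_nonpos hlast le_rfl (by simpa using hzz)
    have h0 : z 0 ≠ 0 := by
      intro h0
      refine hz (funext fun k => ?_)
      by_cases hk : k = 0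
      · simpa [hk] using h0
      · exact hz' k hk
    have hwlast : w (Fin.last n) = 0 := by
      rw [herm_eq_of_support_zero hz'] at hzw
      simpa [h0] using hzw
    have hw' := eq_zero_of_herm_self_nonpos hwlast hr hww
    refine ⟨(z 0)⁻¹ * w 0, funext fun k => ?_⟩
    by_cases hk : k = 0
    · rw [hk, mul_inv_cancel_left₀ h0]
    · rw [hw' k hk, hz' k hk, zero_mul]
  · set c := (z (Fin.last n))⁻¹ * w (Fin.last n)
    set y : Fin (n+1) → ℍq := fun j => z j * c with hy
    have hyr (v : Fin (n+1) → ℍq) : herm n v y = star c * herm n v z := by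
      simpa using herm_mul_right n v z 1 c
    have hyl (v : Fin (n+1) → ℍq) : herm n y v = herm n z v * c := by
      simpa using herm_mul_right n z v c 1
    have hulast : (w - y) (Fin.last n) = 0 := by
      simp [hy, c, mul_inv_cancel_left₀ hlast]
    have huu : herm n (w - y) (w - y) = (r : ℍq) := by
      simp [herm_sub_left, herm_sub_right, hyr, hyl, hwz, hzw, hzz, hww]
    have huz : herm n (w - y) z = 0 := by
      simp [herm_sub_left, hyl, hwz, hzz]
    have hu' := eq_zero_of_herm_self_nonpos hulast hr huu
    rw [herm_eq_of_support_zero hu'] at huz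
    have hu0 : (w - y) 0 = 0 := by simpa [hlast] using huz
    refine ⟨c, sub_eq_zero.1 (funext fun k => ?_)⟩
    by_cases hk : k = 0
    · simpa [hk] using hu0
    · exact hu' k hk

/-- **Semi-normalization of the Gram matrix.** Any `m`-tuple of pairwise projectively
distinct vectors, the first `i` null and the rest negative (`3 ≤ i ≤ m`), can be
rescaled by nonzero quaternions so that its Gram matrix is semi-normalized. -/
theorem exists_semi_normalized_lift (n m i : ℕ) (hi : 3 ≤ i) (him : i ≤ m)
    (z : Fin m → Fin (n+1) → ℍq)
    (hz0 : ∀ k, z k ≠ 0)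
    (hnull : ∀ k : Fin m, (k : ℕ) < i → herm n (z k) (z k) = 0)
    (hneg : ∀ k : Fin m, i ≤ (k : ℕ) → ∃ r : ℝ, r < 0 ∧ herm n (z k) (z k) = (r : ℍq))
    (hdist : ∀ k l : Fin m, k ≠ l → ∀ c : ℍq, z k ≠ fun j => z l j * c) :
    ∃ lam : Fin m → ℍq, (∀ k, lam k ≠ 0) ∧
      SemiNormalized n m i (fun k j => z k j * lam k) := by
  have hpos : 0 < m := by omega
  set o : Fin m := ⟨0, hpos⟩ with ho
  set p : Fin m := ⟨1, by omega⟩ with hp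
  set q : Fin m := ⟨2, by omega⟩ with hq
  have hself : ∀ k, ∃ r : ℝ, r ≤ 0 ∧ herm n (z k) (z k) = (r : ℍq) := by
    intro k
    by_cases hk : (k : ℕ) < i
    · exact ⟨0, le_rfl, by simpa using hnull k hk⟩
    · obtain ⟨r, hr, h⟩ := hneg k (not_lt.1 hk)
      exact ⟨r, hr.le, h⟩
  have hne : ∀ k l : Fin m, (k : ℕ) < i → l ≠ k → herm n (z l) (z k) ≠ 0 := by
    intro k l hk hlk h
    obtain ⟨r, hr, hrl⟩ := hself l
    obtain ⟨c, hc⟩ := exists_eq_mul_of_herm_eq_zero (hz0 k) (hnull k hk) hr hrl h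
    exact hdist l k hlk c hc
  have hg : ∀ l, l ≠ o → herm n (z l) (z o) ≠ 0 := fun l hl =>
    hne o l (by simp [ho]; omega) hl
  have hpo : p ≠ o := by simp [hp, ho]
  have hqo : q ≠ o := by simp [hq, ho]
  have hpq : herm n (z q) (z p) ≠ 0 := hne p q (by simp [hp]; omega) (by simp [hp, hq])
  have hP := norm_pos_iff.2 (hg p hpo)
  have hQ := norm_pos_iff.2 (hg q hqo)
  have hPQ := norm_pos_iff.2 hpq
  obtain ⟨t, ht, htt⟩ : ∃ t : ℝ, 0 < t ∧ t ^ 2 =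
      ‖herm n (z q) (z p)‖ / (‖herm n (z p) (z o)‖ * ‖herm n (z q) (z o)‖) :=
    ⟨_, Real.sqrt_pos.2 (by positivity), Real.sq_sqrt (by positivity)⟩
  have hs : ∀ k : Fin m, ∃ s : ℝ, 0 < s ∧ ((k : ℕ) < i → s = t⁻¹) ∧ (i ≤ (k : ℕ) →
      ∃ r : ℝ, herm n (z k) (z k) = (r : ℍq) ∧ r * s ^ 2 = -‖herm n (z k) (z o)‖ ^ 2) := by
    intro k
    by_cases hk : (k : ℕ) < i
    · exact ⟨t⁻¹, by positivity, fun _ => rfl, fun h => absurd hk (not_lt.2 h)⟩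
    · obtain ⟨r, hr, h⟩ := hneg k (not_lt.1 hk)
      have hko : k ≠ o := by
        rintro rfl
        exact hk (by simp [ho]; omega)
      have hK := norm_pos_iff.2 (hg k hko)
      have hr' : 0 < -r := neg_pos.2 hr
      refine ⟨‖herm n (z k) (z o)‖ / √(-r), by positivity, fun h => absurd h hk,
        fun _ => ⟨r, h, ?_⟩⟩
      rw [div_pow, Real.sq_sqrt hr'.le, div_neg, mul_neg, mul_div_cancel₀ _ hr.ne]
  choose s hs0 hst hsr using hs
  set lam : Fin m → ℍq := fun k =>
    if k = o then (t : ℍq) else (herm n (z k) (z o))⁻¹ * (s k : ℍq) with hlam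
  have hlo : lam o = (t : ℍq) := by simp [hlam]
  have hlk : ∀ k, k ≠ o → lam k = (herm n (z k) (z o))⁻¹ * (s k : ℍq) := fun k hk => by
    simp [hlam, hk]
  have hcoe : ∀ x : ℝ, 0 < x → (x : ℍq) ≠ 0 := fun x hx h => by
    simpa using hx.ne' (Quaternion.coe_injective (by simpa using h))
  have hlam0 : ∀ k, lam k ≠ 0 := by
    intro k
    by_cases hk : k = o
    · rw [hk, hlo]
      exact hcoe t ht
    · rw [hlk k hk]
      exact mul_ne_zero (inv_ne_zero (hg k hk)) (hcoe _ (hs0 k))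
  have hfirst : ∀ k, k ≠ o → herm n (fun j => z k j * lam k) (fun j => z o j * lam o) =
      ((t * s k : ℝ) : ℍq) := by
    intro k hk
    rw [herm_mul_right, hlo, hlk k hk, mul_assoc, mul_inv_cancel_left₀ (hg k hk)]
    simp
  have hnorm : ∀ k, k ≠ o → ‖lam k‖ = s k / ‖herm n (z k) (z o)‖ := by
    intro k hk
    rw [hlk k hk, norm_mul, norm_inv, Quaternion.norm_coe, Real.norm_of_nonneg (hs0 k).le]
    ring
  refine ⟨lam, hlam0, ?_, ?_, ?_, ?_, ?_, ?_, ?_⟩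
  · intro k h
    refine hz0 k (funext fun j => ?_)
    simpa [hlam0 k] using congrFun h j
  · intro k l hkl c h
    refine hdist k l hkl (lam l * c * (lam k)⁻¹) (funext fun j => ?_)
    have hj : z k j * lam k = z l j * lam l * c := congrFun h j
    rw [← mul_assoc, ← mul_assoc, ← hj, mul_inv_cancel_right₀ (hlam0 k)]
  · intro k hk
    rw [herm_mul_right, hnull k hk]
    simp
  · intro k j hk hj
    obtain rfl : k = p := Fin.ext hk
    obtain rfl : j = q := Fin.ext hj
    rw [herm_mul_right, norm_mul, norm_mul, Quaternion.norm_star, hnorm p hpo, hnorm q hqo,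
      hst p (by simp [hp]; omega), hst q (by simp [hq]; omega)]
    rw [eq_div_iff (by positivity)] at htt
    field_simp
    rw [← htt]
    ring
  · intro k j hk hj hji
    obtain rfl : k = o := Fin.ext hk
    have hjo : j ≠ o := by
      rintro rfl
      simp [ho] at hj
    rw [hfirst j hjo, hst j hji, mul_inv_cancel₀ ht.ne']
    simp
  · intro k hk
    have hko : k ≠ o := by
      rintro rfl
      simp [ho] at hk
      omega
    obtain ⟨r, hr, hrs⟩ := hsr k hk
    have hK := norm_pos_iff.2 (hg k hko)
    rw [herm_mul_right, hr, ← Quaternion.coe_commutes, mul_assoc, Quaternion.star_mul_self,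
      Quaternion.normSq_eq_norm_mul_self, hnorm k hko, ← Quaternion.coe_mul]
    have : r * (s k / ‖herm n (z k) (z o)‖ * (s k / ‖herm n (z k) (z o)‖)) = -1 := by
      field_simp
      linarith
    rw [this]
    simp
  · intro k j hk hj
    obtain rfl : k = o := Fin.ext hk
    have hjo : j ≠ o := by
      rintro rfl
      simp [ho] at hj
      omega
    exact ⟨t * s j, mul_pos ht (hs0 j), hfirst j hjo⟩
end
end

section
/- Let 3 ≤ i ≤ m and let p and q be semi-normalized m-tuples in ℍ^{n+1} (each with its first i entries null and remaining entries negative), with Gram matrices G₁ and G₂. Then G₁ and G₂ are equivalent (i.e. G₁ = D* G₂ D for some invertible diagonal quaternionic matrix D) if and only if there exists a unit quaternion μ such that (G₁)_{kj} = conj(μ)·(G₂)_{kj}·μ for all k, j. -/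
noncomputable section

open Quaternion Matrix
open scoped Classical

/-- Unit quaternions `a`, `b` coincide as soon as `star a * s * b` is a positive real for some
positive real `s`. -/
theorem eq_of_star_mul_coe_mul_eq_coe {a b : ℍq} (ha : ‖a‖ = 1) (hb : ‖b‖ = 1) {r s : ℝ}
    (hr : 0 < r) (hs : 0 < s) (h : (r : ℍq) = star a * (s : ℍq) * b) : b = a := by
  have hrs : r = s := by
    simpa [ha, hb, norm_star, Quaternion.norm_coe, abs_of_pos hr, abs_of_pos hs]
      using congrArg norm h
  subst hrs
  have hr' : (r : ℍq) ≠ 0 := by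
    rw [← norm_pos_iff, Quaternion.norm_coe]
    exact norm_pos_iff.2 hr.ne'
  have hab : star a * b = 1 := by
    apply mul_left_cancel₀ hr'
    rw [mul_one, ← mul_assoc, Quaternion.coe_commutes, ← h]
  have haa : a * star a = 1 := by
    rw [Quaternion.self_mul_star, Quaternion.normSq_eq_norm_mul_self, ha]
    simp
  calc b = a * star a * b := by rw [haa, one_mul]
    _ = a := by rw [mul_assoc, hab, mul_one]

/-- **Equivalence of semi-normalized Gram matrices.** The Gram matrices of two
semi-normalized `m`-tuples are equivalent (via an invertible diagonal matrix) if and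
only if they are conjugate entrywise by a single unit quaternion. -/
theorem semi_normalized_gram_equiv_iff (n m i : ℕ) (hi : 3 ≤ i) (him : i ≤ m)
    (p q : Fin m → Fin (n+1) → ℍq)
    (hp : SemiNormalized n m i p) (hq : SemiNormalized n m i q) :
    (∃ D : Fin m → ℍq, (∀ k, D k ≠ 0) ∧
        ∀ k j : Fin m, herm n (p j) (p k) = star (D k) * herm n (q j) (q k) * D j) ↔
      (∃ μ : ℍq, ‖μ‖ = 1 ∧
        ∀ k j : Fin m, herm n (p j) (p k) = star μ * herm n (q j) (q k) * μ) := by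
  obtain ⟨-, -, -, hp23, hp1, hpn, hpr⟩ := hp
  obtain ⟨-, -, -, hq23, hq1, hqn, hqr⟩ := hq
  constructor
  · rintro ⟨D, -, hG⟩
    let e₀ : Fin m := ⟨0, by omega⟩
    let e₁ : Fin m := ⟨1, by omega⟩
    let e₂ : Fin m := ⟨2, by omega⟩
    have hnull : ∀ j : Fin m, 1 ≤ (j : ℕ) → (j : ℕ) < i → 1 = star (D e₀) * D j := by
      intro j h1 h2
      have h := hG e₀ j
      rwa [hp1 e₀ j rfl h1 h2, hq1 e₀ j rfl h1 h2, mul_one] at h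
    have hnorm : ∀ j : Fin m, 1 ≤ (j : ℕ) → (j : ℕ) < i → 1 = ‖D e₀‖ * ‖D j‖ := by
      intro j h1 h2
      rw [← norm_star, ← norm_mul, ← hnull j h1 h2, norm_one]
    have h01 := hnorm e₁ le_rfl (by simp only [e₁]; omega)
    have h02 := hnorm e₂ one_le_two (by simp only [e₂]; omega)
    have h12 : 1 = ‖D e₁‖ * ‖D e₂‖ := by
      simpa [norm_star, hp23 e₁ e₂ rfl rfl, hq23 e₁ e₂ rfl rfl] using congrArg norm (hG e₁ e₂)
    have hD₀ : ‖D e₀‖ = 1 := by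
      have : ‖D e₀‖ ^ 2 = 1 := by
        calc ‖D e₀‖ ^ 2 = ‖D e₀‖ ^ 2 * (‖D e₁‖ * ‖D e₂‖) := by rw [← h12, mul_one]
          _ = (‖D e₀‖ * ‖D e₁‖) * (‖D e₀‖ * ‖D e₂‖) := by ring
          _ = 1 := by rw [← h01, ← h02, mul_one]
      exact (pow_eq_one_iff_of_nonneg (norm_nonneg _) two_ne_zero).1 this
    have hD : ∀ j, D j = D e₀ := by
      intro j
      by_cases hj : (j : ℕ) < i
      · rcases Nat.eq_zero_or_pos (j : ℕ) with h0 | h0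
        · exact congrArg D (Fin.ext h0)
        · refine eq_of_star_mul_coe_mul_eq_coe hD₀ ?_ one_pos one_pos ?_
          · simpa [hD₀] using (hnorm j h0 hj).symm
          · simpa using hnull j h0 hj
      · rw [not_lt] at hj
        have hj1 : ‖D j‖ = 1 := by
          have h : 1 = ‖D j‖ * ‖D j‖ := by
            simpa [norm_star, hpn j hj, hqn j hj] using congrArg norm (hG j j)
          nlinarith [norm_nonneg (D j)]
        obtain ⟨r, hr, hpj⟩ := hpr e₀ j rfl hj
        obtain ⟨s, hs, hqj⟩ := hqr e₀ j rfl hj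
        refine eq_of_star_mul_coe_mul_eq_coe hD₀ hj1 hr hs ?_
        rw [← hpj, ← hqj]
        exact hG e₀ j
    refine ⟨D e₀, hD₀, fun k j => ?_⟩
    rw [hG k j, hD k, hD j]
  · rintro ⟨μ, hμ, hG⟩
    exact ⟨fun _ => μ, fun _ => norm_ne_zero_iff.1 (by simp [hμ]), hG⟩
end
end
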